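/- Let V be a finite-dimensional real vector space, Q a quadratic form on V, and T : V → V a linear involution (T ∘ T = id) satisfying Q(T x) = Q(x) for all x ∈ V. Let V₊ = {x ∈ V : T x = x} and V₋ = {x ∈ V : T x = −x}. For a subspace W ⊆ V, define the negative index of Q on W as the largest dimension of a subspace U ⊆ W on which Q is negative definite (i.e. Q(x) < 0 for all nonzero x ∈ U). Then the negative index of Q on V equals the negative index of Q on V₊ plus the negative index of Q on V₋. -/

import Mathlib

/-- The negative index of a quadratic form `Q` on a subspace `W`: the largest dimension of
a subspace `U ⊆ W` on which `Q` is negative definite. -/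
noncomputable def negIndex {V : Type*} [AddCommGroup V] [Module ℝ V]
    (Q : QuadraticForm ℝ V) (W : Submodule ℝ V) : ℕ :=
  sSup {n : ℕ | ∃ U : Submodule ℝ V, U ≤ W ∧ (∀ x ∈ U, x ≠ 0 → Q x < 0) ∧
    Module.finrank ℝ U = n}

/-- A quadratic form is nonnegative on some subspace of dimension complementary to `sigNeg`. -/
lemma QuadraticForm.exists_nonneg_finrank_add_sigNeg {V : Type*} [AddCommGroup V] [Module ℝ V]
    [FiniteDimensional ℝ V] (Q : QuadraticForm ℝ V) :
    ∃ P : Submodule ℝ V, (∀ x ∈ P, 0 ≤ Q x) ∧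
      Module.finrank ℝ P + sigNeg Q = Module.finrank ℝ V := by
  obtain ⟨P, hP, hpos⟩ := exists_finrank_eq_sigPos_and_posDef Q
  have hpos' : ∀ x ∈ P, x ≠ 0 → 0 < Q x := fun x hx hx0 ↦
    hpos ⟨x, hx⟩ (by simpa using hx0)
  refine ⟨P ⊔ Q.radical, fun x hx ↦ ?_, ?_⟩
  · obtain ⟨p, hp, r, hr, rfl⟩ := Submodule.mem_sup.mp hx
    rw [add_comm, (QuadraticMap.mem_radical_iff'.mp hr).2 p]
    rcases eq_or_ne p 0 with rfl | hp0
    · simp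
    · exact (hpos' p hp hp0).le
  · have hdisj : P ⊓ Q.radical = ⊥ := by
      refine (Submodule.eq_bot_iff _).mpr fun x hx ↦ ?_
      by_contra hx0
      exact (hpos' x hx.1 hx0).ne' (QuadraticMap.mem_radical_iff'.mp hx.2).1
    have hdim := Submodule.finrank_sup_add_finrank_inf_eq P Q.radical
    have hsig := QuadraticForm.sigPos_add_sigNeg_add_radical (Q := Q)
    rw [hdisj, finrank_bot] at hdim
    lia

section negIndex

variable {V : Type*} [AddCommGroup V] [Module ℝ V] [FiniteDimensional ℝ V]
  (Q : QuadraticForm ℝ V)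

lemma negIndex_isGreatest (W : Submodule ℝ V) :
    IsGreatest {n : ℕ | ∃ U : Submodule ℝ V, U ≤ W ∧ (∀ x ∈ U, x ≠ 0 → Q x < 0) ∧
      Module.finrank ℝ U = n} (negIndex Q W) := by
  have hbdd : BddAbove {n : ℕ | ∃ U : Submodule ℝ V, U ≤ W ∧ (∀ x ∈ U, x ≠ 0 → Q x < 0) ∧
      Module.finrank ℝ U = n} := by
    refine ⟨Module.finrank ℝ V, ?_⟩
    rintro _ ⟨U, -, -, rfl⟩
    exact U.finrank_le
  exact ⟨Nat.sSup_mem ⟨0, ⊥, bot_le, by simp, finrank_bot ℝ V⟩ hbdd, fun n hn ↦ le_csSup hbdd hn⟩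

lemma negIndex_le_sigNeg_restrict (W : Submodule ℝ V) :
    negIndex Q W ≤ sigNeg (Q.restrict W) := by
  obtain ⟨U, hUW, hU, hdim⟩ := (negIndex_isGreatest Q W).1
  rw [← hdim, ← (Submodule.comapSubtypeEquivOfLe hUW).finrank_eq]
  refine le_sigNeg_of_negDef _ fun x hx ↦ ?_
  have := hU x.1 x.2 (by simpa using hx)
  simpa using this

lemma sigNeg_restrict_le_negIndex (W : Submodule ℝ V) :
    sigNeg (Q.restrict W) ≤ negIndex Q W := by
  obtain ⟨U, hdim, hU⟩ := exists_finrank_eq_sigNeg_and_negDef (Q.restrict W)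
  refine (negIndex_isGreatest Q W).2 ⟨U.map W.subtype, Submodule.map_subtype_le W U, ?_, ?_⟩
  · rintro _ ⟨x, hx, rfl⟩ hx0
    have := hU ⟨x, hx⟩ (by simpa using hx0)
    simpa using this
  · rw [Submodule.finrank_map_subtype_eq, hdim]

lemma negIndex_eq_sigNeg_restrict (W : Submodule ℝ V) :
    negIndex Q W = sigNeg (Q.restrict W) :=
  (negIndex_le_sigNeg_restrict Q W).antisymm (sigNeg_restrict_le_negIndex Q W)

lemma exists_nonneg_finrank_add_negIndex (W : Submodule ℝ V) :
    ∃ P ≤ W, (∀ x ∈ P, 0 ≤ Q x) ∧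
      Module.finrank ℝ P + negIndex Q W = Module.finrank ℝ W := by
  obtain ⟨P, hP, hdim⟩ := QuadraticForm.exists_nonneg_finrank_add_sigNeg (Q.restrict W)
  refine ⟨P.map W.subtype, Submodule.map_subtype_le W P, ?_, ?_⟩
  · rintro _ ⟨x, hx, rfl⟩
    exact hP x hx
  · rw [Submodule.finrank_map_subtype_eq, negIndex_eq_sigNeg_restrict, hdim]

variable {Q}

/-- The negative index is additive over complementary subspaces orthogonal for `Q`. -/
lemma negIndex_top_of_isCompl {W₁ W₂ : Submodule ℝ V} (hc : IsCompl W₁ W₂)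
    (horth : ∀ a ∈ W₁, ∀ b ∈ W₂, Q (a + b) = Q a + Q b) :
    negIndex Q ⊤ = negIndex Q W₁ + negIndex Q W₂ := by
  have finrank_sup {A B : Submodule ℝ V} (hA : A ≤ W₁) (hB : B ≤ W₂) :
      Module.finrank ℝ ↥(A ⊔ B) = Module.finrank ℝ A + Module.finrank ℝ B := by
    have h := Submodule.finrank_sup_add_finrank_inf_eq A B
    rwa [(hc.disjoint.mono hA hB).eq_bot, finrank_bot, add_zero] at h
  apply le_antisymm
  · obtain ⟨P₁, hP₁W, hP₁, hd₁⟩ := exists_nonneg_finrank_add_negIndex Q W₁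
    obtain ⟨P₂, hP₂W, hP₂, hd₂⟩ := exists_nonneg_finrank_add_negIndex Q W₂
    obtain ⟨U, -, hU, hdU⟩ := (negIndex_isGreatest Q ⊤).1
    have hdisj : Disjoint U (P₁ ⊔ P₂) := by
      refine Submodule.disjoint_def.mpr fun x hxU hxP ↦ ?_
      by_contra hx0
      have hneg := hU x hxU hx0
      obtain ⟨a, ha, b, hb, rfl⟩ := Submodule.mem_sup.mp hxP
      rw [horth a (hP₁W ha) b (hP₂W hb)] at hneg
      linarith [hP₁ a ha, hP₂ b hb]
    have hle := Submodule.finrank_add_finrank_le_of_disjoint hdisj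
    have hW := Submodule.finrank_add_eq_of_isCompl hc
    rw [finrank_sup hP₁W hP₂W] at hle
    lia
  · obtain ⟨U₁, hU₁W, hU₁, hd₁⟩ := (negIndex_isGreatest Q W₁).1
    obtain ⟨U₂, hU₂W, hU₂, hd₂⟩ := (negIndex_isGreatest Q W₂).1
    refine (negIndex_isGreatest Q ⊤).2 ⟨U₁ ⊔ U₂, le_top, fun x hx hx0 ↦ ?_, ?_⟩
    · obtain ⟨a, ha, b, hb, rfl⟩ := Submodule.mem_sup.mp hx
      rw [horth a (hU₁W ha) b (hU₂W hb)]
      rcases eq_or_ne a 0 with rfl | ha0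
      · simpa using hU₂ b hb (by simpa using hx0)
      · rcases eq_or_ne b 0 with rfl | hb0
        · simpa using hU₁ a ha ha0
        · exact add_neg (hU₁ a ha ha0) (hU₂ b hb hb0)
    · rw [finrank_sup hU₁W hU₂W, hd₁, hd₂]

end negIndex

/-- If `T` is a linear involution of a finite-dimensional real vector space `V` preserving a
quadratic form `Q`, then the negative index of `Q` on `V` is the sum of the negative indices
of `Q` on the `+1` and `−1` eigenspaces of `T`. -/
theorem negIndex_decomp_involution (V : Type*) [AddCommGroup V] [Module ℝ V]
    [FiniteDimensional ℝ V]
    (Q : QuadraticForm ℝ V) (T : V →ₗ[ℝ] V) (hT : T ∘ₗ T = LinearMap.id)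
    (hQT : ∀ x : V, Q (T x) = Q x)
    (Vp Vm : Submodule ℝ V)
    (hVp : ∀ x : V, x ∈ Vp ↔ T x = x) (hVm : ∀ x : V, x ∈ Vm ↔ T x = -x) :
    negIndex Q ⊤ = negIndex Q Vp + negIndex Q Vm := by
  refine negIndex_top_of_isCompl ⟨?_, ?_⟩ fun a ha b hb ↦ ?_
  · refine Submodule.disjoint_def.mpr fun x hp hm ↦ ?_
    have : IsAddTorsionFree V := .of_isTorsionFree ℝ V
    exact self_eq_neg.mp (((hVp x).mp hp).symm.trans ((hVm x).mp hm))
  · refine codisjoint_iff.mpr (eq_top_iff.mpr fun x _ ↦ ?_)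
    have hTT : T (T x) = x := LinearMap.congr_fun hT x
    refine Submodule.mem_sup.mpr ⟨(2⁻¹ : ℝ) • (x + T x), (hVp _).mpr ?_,
      (2⁻¹ : ℝ) • (x - T x), (hVm _).mpr ?_, ?_⟩
    · rw [map_smul, map_add, hTT, add_comm]
    · rw [map_smul, map_sub, hTT, ← smul_neg, neg_sub]
    · module
  · have h := hQT (a + b)
    rw [map_add, (hVp a).mp ha, (hVm b).mp hb, QuadraticMap.map_add Q a b,
      QuadraticMap.map_add Q a (-b), QuadraticMap.map_neg, QuadraticMap.polar_neg_right] at h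
    rw [QuadraticMap.map_add Q a b]
    linarith
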